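/- Let P be a toric monoid and I ⊆ P an ideal. In the monoid algebra ℤ[P] (the commutative ring AddMonoidAlgebra ℤ P, with monomials z^p for p ∈ P), let J be the ideal generated by {z^b : b ∈ I}. Then the integral closure of J, namely J^nor = {x ∈ ℤ[P] : x^n + c₁x^{n−1} + ⋯ + cₙ = 0 for some n ≥ 1 and elements cᵢ ∈ Jⁱ}, equals the ideal of ℤ[P] generated by {z^b : b ∈ I^sat}, where I^sat = {x ∈ P : m·x ∈ mI for some integer m ≥ 1} and mI = {i₁ + ⋯ + iₘ : i₁,…,iₘ ∈ I}. -/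

import Mathlib

/-- An ideal of a commutative monoid `P`: a subset `I` with `I + P ⊆ I`. -/
def IsIdealAbs {P : Type*} [AddCommMonoid P] (I : Set P) : Prop :=
  ∀ i ∈ I, ∀ m : P, i + m ∈ I

/-- `mJ`: the set of `m`-fold sums `j₁ + ⋯ + jₘ` of elements of `J`. -/
def sumIdealAbs {P : Type*} [AddCommMonoid P] (m : ℕ) (J : Set P) : Set P :=
  {x : P | ∃ f : Fin m → P, (∀ i, f i ∈ J) ∧ x = ∑ i, f i}

/-- `I^sat = {x ∈ P : m·x ∈ mI for some m ≥ 1}`. -/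
def idealSatAbs {P : Type*} [AddCommMonoid P] (I : Set P) : Set P :=
  {x : P | ∃ m : ℕ, 1 ≤ m ∧ m • x ∈ sumIdealAbs m I}

/-- `x` is integral over the ideal `J`: it satisfies a monic equation
`x^n + c₁x^{n−1} + ⋯ + cₙ = 0` with `cᵢ ∈ Jⁱ`. -/
def IsIntegralOverIdeal {A : Type*} [CommRing A] (J : Ideal A) (x : A) : Prop :=
  ∃ n : ℕ, 1 ≤ n ∧ ∃ c : ℕ → A, (∀ i ∈ Finset.Icc 1 n, c i ∈ J ^ i) ∧
    x ^ n + ∑ i ∈ Finset.Icc 1 n, c i * x ^ (n - i) = 0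

/-- A submonoid `S` of a commutative group containing no positive multiple of `g` is contained in a
submonoid `T` with `g ∉ T` and `T ∪ -T` everything. -/
theorem AddSubmonoid.exists_le_mem_or_neg_mem {G : Type*} [AddCommGroup G] (S : AddSubmonoid G)
    (g : G) (hg : ∀ n : ℕ, 1 ≤ n → n • g ∉ S) :
    ∃ T : AddSubmonoid G, S ≤ T ∧ g ∉ T ∧ ∀ h, h ∈ T ∨ -h ∈ T := by
  obtain ⟨T, hST, hT⟩ := zorn_le_nonempty₀
    {T : AddSubmonoid G | ∀ n : ℕ, 1 ≤ n → n • g ∉ T} (fun c hc hchain y hy ↦ by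
      refine ⟨sSup c, fun n hn hmem ↦ ?_, fun z hz ↦ le_sSup hz⟩
      obtain ⟨s, hs, hmem⟩ :=
        (AddSubmonoid.mem_sSup_of_directedOn ⟨y, hy⟩ hchain.directedOn).1 hmem
      exact hc hs n hn hmem) S hg
  have key : ∀ h ∉ T, ∃ n : ℕ, 1 ≤ n ∧ ∃ t ∈ T, ∃ a : ℕ, n • g = t + a • h := by
    intro h hh
    by_contra! H
    refine hh (hT.2 (y := T ⊔ AddSubmonoid.multiples h) (fun n hn hmem ↦ ?_) le_sup_left
      (AddSubmonoid.mem_sup_right (AddSubmonoid.mem_multiples h)))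
    obtain ⟨t, ht, u, ⟨a, rfl⟩, htu⟩ := AddSubmonoid.mem_sup.1 hmem
    exact H n hn t ht a htu.symm
  refine ⟨T, hST, fun h ↦ hT.1 1 le_rfl (by simpa using h), fun h ↦ ?_⟩
  by_contra! H
  obtain ⟨n, hn, t, ht, a, hnt⟩ := key h H.1
  obtain ⟨m, hm, s, hs, b, hms⟩ := key (-h) H.2
  rcases Nat.eq_zero_or_pos b with rfl | hb
  · exact hT.1 m hm (by simpa [hms] using hs)
  · refine hT.1 (b * n + a * m) (Nat.le_add_right_of_le (Nat.mul_pos hb hn)) ?_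
    have : (b * n + a * m) • g = b • t + a • s := by
      rw [add_smul, mul_smul, mul_smul, hnt, hms, smul_add, smul_add, smul_neg, smul_neg,
        smul_smul, smul_smul, mul_comm b a]
      abel
    rw [this]
    exact add_mem (nsmul_mem ht b) (nsmul_mem hs a)

/-- A submonoid `S` of a commutative group and an element no positive multiple of which lies in `S`
are separated by a homomorphism to a linearly ordered group. -/
theorem AddSubmonoid.exists_hom_nonneg_of_nsmul_notMem.{u} {G : Type u} [AddCommGroup G]
    (S : AddSubmonoid G) (g : G) (hg : ∀ n : ℕ, 1 ≤ n → n • g ∉ S) :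
    ∃ (Γ : Type u) (_ : AddCommGroup Γ) (_ : LinearOrder Γ) (_ : IsOrderedAddMonoid Γ)
      (π : G →+ Γ), (∀ x ∈ S, 0 ≤ π x) ∧ π g < 0 := by
  classical
  obtain ⟨T, hST, hgT, hT⟩ := S.exists_le_mem_or_neg_mem g hg
  let N : AddSubgroup G :=
    { carrier := {x | x ∈ T ∧ -x ∈ T}
      add_mem' := fun {a b} ha hb ↦
        ⟨add_mem ha.1 hb.1, by rw [neg_add]; exact add_mem ha.2 hb.2⟩
      zero_mem' := by simp
      neg_mem' := fun {a} ha ↦ ⟨ha.2, by simpa using ha.1⟩ }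
  let π : G →+ G ⧸ N := QuotientAddGroup.mk' N
  have hπ : ∀ x, π x ∈ T.map π ↔ x ∈ T := by
    refine fun x ↦ ⟨?_, fun hx ↦ ⟨x, hx, rfl⟩⟩
    rintro ⟨y, hy, hxy⟩
    have : -y + x ∈ N := QuotientAddGroup.eq.1 hxy
    simpa using add_mem hy this.1
  let C : AddGroupCone (G ⧸ N) :=
    { T.map π with
      eq_zero_of_mem_of_neg_mem' := by
        intro a ha hna
        obtain ⟨x, rfl⟩ := QuotientAddGroup.mk'_surjective N a
        exact (QuotientAddGroup.eq_zero_iff x).2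
          ⟨(hπ x).1 ha, (hπ (-x)).1 (by rw [map_neg]; exact hna)⟩ }
  have hC : ∀ x, π x ∈ C ↔ x ∈ T := hπ
  have : HasMemOrNegMem C := ⟨fun a ↦ by
    obtain ⟨x, rfl⟩ := QuotientAddGroup.mk'_surjective N a
    exact (hT x).imp (hC x).2 fun h ↦ by simpa only [map_neg] using (hC (-x)).2 h⟩
  let _ := LinearOrder.mkOfAddGroupCone C
  have hle : ∀ x, 0 ≤ π x ↔ x ∈ T := fun x ↦ by
    rw [← hC x]
    change π x - 0 ∈ C ↔ _
    rw [sub_zero]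
  exact ⟨G ⧸ N, inferInstance, inferInstance, IsOrderedAddMonoid.mkOfCone C, π,
    fun x hx ↦ (hle x).2 (hST hx), not_le.1 fun h ↦ hgT ((hle g).1 h)⟩

/-- A homomorphism from `P` to a linearly ordered group extends to a monomial valuation on a monoid
algebra over `P`. -/
theorem AddMonoidAlgebra.exists_addValuation_of_hom {R P Γ : Type*} [CommRing R] [AddCommMonoid P]
    [IsDomain (AddMonoidAlgebra R P)] [AddCommGroup Γ] [LinearOrder Γ] [IsOrderedAddMonoid Γ]
    (f : P →+ Γ) :
    ∃ v : AddValuation (AddMonoidAlgebra R P) (WithTop Γ),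
      (∀ p r, (f p : WithTop Γ) ≤ v (single p r)) ∧
      ∀ x, ∀ q ∈ x.coeff.support, v x ≤ f q := by
  classical
  let F : Multiplicative P →* HahnSeries Γ (AddMonoidAlgebra R P) :=
    { toFun := fun p ↦ HahnSeries.single (f p.toAdd) (single p.toAdd 1)
      map_one' := by simp [← AddMonoidAlgebra.one_def]
      map_mul' := fun p q ↦ by simp [AddMonoidAlgebra.single_mul_single] }
  let φ := lift R (HahnSeries Γ (AddMonoidAlgebra R P)) P F
  have hφ : ∀ p r, φ (single p r) = HahnSeries.single (f p) (single p r) := fun p r ↦ by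
    simp only [φ, lift_single]
    change r • HahnSeries.single (f p) (single p (1 : R)) = _
    ext γ : 2
    by_cases h : γ = f p <;> simp [h]
  have hcoeff : ∀ x q, ((φ x).coeff (f q)).coeff q = x.coeff q := by
    intro x q
    induction x using AddMonoidAlgebra.induction_linear with
    | zero => simp
    | add x y hx hy => simp [hx, hy]
    | single p r =>
      rw [hφ, HahnSeries.coeff_single]
      by_cases hpq : p = q
      · simp [hpq]
      · split_ifs <;> simp [hpq]
  refine ⟨(HahnSeries.addVal Γ (AddMonoidAlgebra R P)).comap φ.toRingHom, fun p r ↦ ?_,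
    fun x q hq ↦ HahnSeries.addVal_le_of_coeff_ne_zero fun h ↦ ?_⟩
  · change (f p : WithTop Γ) ≤ HahnSeries.addVal Γ _ (φ (single p r))
    rw [hφ, HahnSeries.addVal_apply]
    exact HahnSeries.orderTop_single_le
  · change (φ x).coeff (f q) = 0 at h
    have := hcoeff x q
    rw [h] at this
    exact (Finsupp.mem_support_iff.1 hq) (by simpa using this.symm)

/-- The value of an element integral over an ideal is bounded below by that of the ideal. -/
theorem IsIntegralOverIdeal.le_addValuation {A Γ : Type*} [CommRing A] [AddCommGroup Γ]
    [LinearOrder Γ] [IsOrderedAddMonoid Γ] (v : AddValuation A (WithTop Γ)) (hv : ∀ a, 0 ≤ v a)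
    {J : Ideal A} {δ : Γ} (hJ : ∀ a ∈ J, (δ : WithTop Γ) ≤ v a) {x : A}
    (hx : IsIntegralOverIdeal J x) : (δ : WithTop Γ) ≤ v x := by
  obtain ⟨n, hn, c, hc, h⟩ := hx
  by_contra! hlt
  obtain ⟨γ, hγ⟩ := WithTop.ne_top_iff_exists.1 hlt.ne_top
  rw [← hγ, WithTop.coe_lt_coe] at hlt
  have hpow : ∀ (i : ℕ), ∀ a ∈ J ^ i, ((i • δ : Γ) : WithTop Γ) ≤ v a := by
    intro i a ha
    induction ha using Submodule.pow_induction_on_left' with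
    | algebraMap r => simpa using hv r
    | add x y i hx hy hx' hy' => exact v.map_le_add hx' hy'
    | mem_mul m hm i x hx ih =>
      rw [v.map_mul, succ_nsmul', WithTop.coe_add]
      exact add_le_add (hJ m hm) ih
  have hsum : ((n • γ : Γ) : WithTop Γ) < v (∑ i ∈ Finset.Icc 1 n, c i * x ^ (n - i)) := by
    refine v.map_lt_sum WithTop.coe_ne_top fun i hi ↦ ?_
    obtain ⟨hi1, hin⟩ := Finset.mem_Icc.1 hi
    have hlt' : ((n • γ : Γ) : WithTop Γ) < ((i • δ + (n - i) • γ : Γ) : WithTop Γ) := by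
      rw [WithTop.coe_lt_coe]
      nth_rw 1 [← Nat.add_sub_cancel' hin]
      rw [add_smul]
      exact add_lt_add_left (nsmul_lt_nsmul_right (by omega) hlt) _
    refine hlt'.trans_le ?_
    rw [v.map_mul, v.map_pow, ← hγ, WithTop.coe_add, WithTop.coe_nsmul γ (n - i)]
    exact add_le_add_left (hpow i _ (hc i hi)) _
  rw [← neg_eq_of_add_eq_zero_right h, v.map_neg, v.map_pow, ← hγ, ← WithTop.coe_nsmul] at hsum
  exact lt_irrefl _ hsum

/-- If `x t` is integral over the Rees algebra of `J`, then `x` is integral over `J`. -/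
theorem IsIntegralOverIdeal.of_isIntegral_reesAlgebra {A : Type*} [CommRing A] {J : Ideal A} {x : A}
    (hx : IsIntegral (reesAlgebra J) (Polynomial.monomial 1 x)) : IsIntegralOverIdeal J x := by
  obtain ⟨p, hp, h⟩ := hx
  cases subsingleton_or_nontrivial A
  · exact ⟨1, le_rfl, 0, by simp, Subsingleton.elim _ _⟩
  have hn : 1 ≤ p.natDegree := by
    by_contra! hn
    rw [hp.natDegree_eq_zero.1 (by omega), Polynomial.eval₂_one] at h
    exact one_ne_zero h
  refine ⟨p.natDegree, hn,
    fun j ↦ (p.coeff (p.natDegree - j) : Polynomial A).coeff j, fun j _ ↦ (p.coeff _).2 j, ?_⟩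
  have h' := congr_arg (Polynomial.coeff · p.natDegree) h
  simp only [Polynomial.eval₂_eq_sum_range, Polynomial.coeff_add, Polynomial.finsetSum_coeff, Polynomial.monomial_pow,
    one_mul, Polynomial.coeff_zero, Finset.sum_range_succ, hp.coeff_natDegree, map_one,
    Polynomial.coeff_monomial_same] at h'
  rw [add_comm, ← h']
  congr 1
  refine Finset.sum_nbij' (p.natDegree - ·) (p.natDegree - ·) (fun i hi ↦ ?_) (fun i hi ↦ ?_)
    (fun i hi ↦ ?_) (fun i hi ↦ ?_) (fun i hi ↦ ?_)
  any_goals simp only [Finset.mem_Icc, Finset.mem_range] at hi ⊢; omega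
  obtain ⟨-, hin⟩ := Finset.mem_Icc.1 hi
  nth_rw 6 [← Nat.add_sub_cancel' hin]
  rw [Polynomial.coeff_mul_monomial]
  rfl

/-- The `m`-fold sums of elements of an ideal form an ideal for `m ≥ 1`. -/
theorem IsIdealAbs.add_mem_sumIdealAbs {P : Type*} [AddCommMonoid P] {I : Set P}
    (hI : IsIdealAbs I) {m : ℕ} (hm : m ≠ 0) {x : P} (hx : x ∈ sumIdealAbs m I) (p : P) :
    x + p ∈ sumIdealAbs m I := by
  obtain ⟨k, rfl⟩ := Nat.exists_eq_succ_of_ne_zero hm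
  obtain ⟨f, hf, rfl⟩ := hx
  refine ⟨Fin.cons (f 0 + p) (Fin.tail f), Fin.cases (hI _ (hf 0) p) fun i ↦ hf i.succ, ?_⟩
  simp [Fin.sum_univ_succ, Fin.tail, add_right_comm]

theorem add_mem_sumIdealAbs_add {P : Type*} [AddCommMonoid P] {I : Set P} {m n : ℕ} {x y : P}
    (hx : x ∈ sumIdealAbs m I) (hy : y ∈ sumIdealAbs n I) : x + y ∈ sumIdealAbs (m + n) I := by
  obtain ⟨f, hf, rfl⟩ := hx
  obtain ⟨g, hg, rfl⟩ := hy
  refine ⟨Fin.append f g, Fin.addCases (by simpa using hf) (by simpa using hg), ?_⟩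
  simp [Fin.sum_univ_add]

/-- The pairs `(p, n)` such that `p` is a sum of `n` elements of the ideal `I`, with no condition on
`p` for `n = 0`: the exponents of the monomials in a Rees algebra. -/
def IsIdealAbs.reesAddSubmonoid {P : Type*} [AddCommMonoid P] {I : Set P} (hI : IsIdealAbs I) :
    AddSubmonoid (P × ℕ) where
  carrier := {x | x.2 ≠ 0 → x.1 ∈ sumIdealAbs x.2 I}
  zero_mem' h := (h rfl).elim
  add_mem' := by
    rintro ⟨a, m⟩ ⟨b, n⟩ ha hb hmn
    simp only [Set.mem_ofPred_eq, Prod.mk_add_mk] at ha hb hmn ⊢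
    rcases eq_or_ne m 0 with rfl | hm
    · rw [add_comm a, zero_add]
      rw [zero_add] at hmn
      exact hI.add_mem_sumIdealAbs hmn (hb hmn) a
    · rcases eq_or_ne n 0 with rfl | hn
      · exact hI.add_mem_sumIdealAbs hm (ha hm) b
      · exact add_mem_sumIdealAbs_add (ha hm) (hb hn)

/-- An element outside the saturation of an ideal `I` is separated from `I` by a homomorphism to a
linearly ordered group which is nonnegative on the monoid. -/
theorem IsIdealAbs.exists_hom_of_notMem_idealSatAbs.{u} {P : Type u} [AddCommMonoid P] [IsCancelAdd P]
    {I : Set P} (hI : IsIdealAbs I) {q : P} (hq : q ∉ idealSatAbs I) :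
    ∃ (Γ : Type u) (_ : AddCommGroup Γ) (_ : LinearOrder Γ) (_ : IsOrderedAddMonoid Γ)
      (f : P →+ Γ) (δ : Γ), (∀ p, 0 ≤ f p) ∧ (∀ b ∈ I, δ ≤ f b) ∧ f q < δ := by
  let ι : P × ℕ →+ Algebra.GrothendieckAddGroup (P × ℕ) := Algebra.GrothendieckAddGroup.of
  have hι : Function.Injective ι := Algebra.GrothendieckAddGroup.of_injective
  obtain ⟨Γ, _, _, _, π, hπ, hπq⟩ :=
    (hI.reesAddSubmonoid.map ι).exists_hom_nonneg_of_nsmul_notMem (ι (q, 1)) fun n hn hmem ↦ by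
      rw [← map_nsmul] at hmem
      obtain ⟨y, hy, hyq⟩ := hmem
      obtain rfl := hι hyq
      have hy' : (n • (q, 1)).2 ≠ 0 → (n • (q, 1)).1 ∈ sumIdealAbs (n • (q, 1)).2 I := hy
      simp only [Prod.smul_mk, smul_eq_mul, mul_one] at hy'
      exact hq ⟨n, hn, hy' (by omega)⟩
  have hsplit : ∀ p, π (ι (p, 1)) = π (ι (p, 0)) + π (ι (0, 1)) := fun p ↦ by
    rw [← map_add, ← map_add]
    simp
  refine ⟨Γ, ‹_›, ‹_›, ‹_›, (π.comp ι).comp (AddMonoidHom.inl P ℕ), -π (ι (0, 1)),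
    fun p ↦ hπ _ ⟨(p, 0), fun h ↦ (h rfl).elim, rfl⟩, fun b hb ↦ ?_, ?_⟩
  · have := hπ (ι (b, 1)) ⟨(b, 1), fun _ ↦ ⟨fun _ ↦ b, fun _ ↦ hb, by simp⟩, rfl⟩
    rw [hsplit] at this
    exact neg_le_iff_add_nonneg.2 this
  · rw [hsplit] at hπq
    exact lt_neg_iff_add_neg.2 hπq

/-- The support of an element of a monoid algebra integral over a monomial ideal is contained in
the saturation of the ideal of exponents. -/
theorem IsIntegralOverIdeal.mem_idealSatAbs {R P : Type*} [CommRing R] [AddCommMonoid P]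
    [IsCancelAdd P] [IsDomain (AddMonoidAlgebra R P)] {I : Set P} (hI : IsIdealAbs I)
    {x : AddMonoidAlgebra R P}
    (hx : IsIntegralOverIdeal
      (Ideal.span ((fun b ↦ (AddMonoidAlgebra.single b 1 : AddMonoidAlgebra R P)) '' I)) x)
    {q : P} (hq : q ∈ x.coeff.support) : q ∈ idealSatAbs I := by
  by_contra hqI
  obtain ⟨Γ, _, _, _, f, δ, hf, hfI, hfq⟩ := hI.exists_hom_of_notMem_idealSatAbs hqI
  obtain ⟨v, hv, hv'⟩ := AddMonoidAlgebra.exists_addValuation_of_hom (R := R) f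
  have hv0 : ∀ a, (0 : WithTop Γ) ≤ v a := by
    intro a
    induction a using AddMonoidAlgebra.induction_linear with
    | zero => simp
    | add x y hx hy => exact v.map_le_add hx hy
    | single p r => exact (WithTop.coe_le_coe.2 (hf p)).trans (hv p r)
  refine (((hx.le_addValuation v hv0 (δ := δ) fun a ha ↦ ?_).trans (hv' x q hq)).trans_lt
    (WithTop.coe_lt_coe.2 hfq)).false
  induction ha using Submodule.span_induction with
  | mem a ha =>
    obtain ⟨b, hb, rfl⟩ := ha
    exact (WithTop.coe_le_coe.2 (hfI b hb)).trans (hv b 1)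
  | zero => simp
  | add x y _ _ hx hy => exact v.map_le_add hx hy
  | smul a x _ hx =>
    rw [smul_eq_mul, v.map_mul]
    exact hx.trans (le_add_of_nonneg_left (hv0 a))

/-- Monomials with exponent in the saturation of `I` are integral over the Rees algebra of the
corresponding monomial ideal. -/
theorem isIntegral_reesAlgebra_single {R P : Type*} [CommRing R] [AddCommMonoid P] {I : Set P}
    {q : P} (hq : q ∈ idealSatAbs I) :
    IsIntegral (reesAlgebra
      (Ideal.span ((fun b ↦ (AddMonoidAlgebra.single b 1 : AddMonoidAlgebra R P)) '' I)))
      (Polynomial.monomial 1 (AddMonoidAlgebra.single q 1 : AddMonoidAlgebra R P)) := by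
  obtain ⟨m, hm, f, hf, hsum⟩ := hq
  refine IsIntegral.of_pow hm ?_
  rw [Polynomial.monomial_pow, one_mul, AddMonoidAlgebra.single_pow, hsum, one_pow]
  have hprod : (AddMonoidAlgebra.single (∑ i, f i) 1 : AddMonoidAlgebra R P) =
      ∏ i, AddMonoidAlgebra.single (f i) 1 := by
    simp
  set J : Ideal (AddMonoidAlgebra R P) := Ideal.span _
  suffices h :
      Polynomial.monomial m (AddMonoidAlgebra.single (∑ i, f i) (1 : R)) ∈ reesAlgebra J from
    isIntegral_algebraMap (x := (⟨_, h⟩ : reesAlgebra J))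
  rw [reesAlgebra.monomial_mem, hprod]
  have hJ : ∀ i, AddMonoidAlgebra.single (f i) (1 : R) ∈ J := fun i ↦
    Ideal.subset_span (Set.mem_image_of_mem _ (hf i))
  simpa [-AddMonoidAlgebra.prod_single] using
    Ideal.prod_mem_prod (s := Finset.univ) (I := fun _ ↦ J) fun i _ ↦ hJ i

/-- `P` is a toric monoid: finitely generated, cancellative, with
torsion-free Grothendieck group (`n•a = n•b → a = b`) and saturated (expressed intrinsically:
if `n•a = n•b + c` for some `c ∈ P` and `n ≥ 1` then `a = b + d` for some `d ∈ P`).  For an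
ideal `I ⊆ P`, the integral closure of the ideal of `ℤ[P]` generated by the monomials
`z^b`, `b ∈ I`, equals the ideal generated by the monomials `z^b`, `b ∈ I^sat`. -/
theorem statement12 {P : Type*} [AddCommMonoid P] [IsCancelAdd P] [AddMonoid.FG P]
    (htf : ∀ (n : ℕ), 0 < n → ∀ a b : P, n • a = n • b → a = b)
    (hsat : ∀ (n : ℕ), 0 < n → ∀ a b : P, (∃ c : P, n • a = n • b + c) → ∃ d : P, a = b + d)
    (I : Set P) (hI : IsIdealAbs I) :
    {x : AddMonoidAlgebra ℤ P |
        IsIntegralOverIdeal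
          (Ideal.span ((fun b : P => (AddMonoidAlgebra.single b 1 : AddMonoidAlgebra ℤ P)) '' I))
          x} =
      (Ideal.span ((fun b : P =>
          (AddMonoidAlgebra.single b 1 : AddMonoidAlgebra ℤ P)) '' idealSatAbs I) :
        Set (AddMonoidAlgebra ℤ P)) := by
  have : IsAddTorsionFree P := ⟨fun n hn a b h ↦ htf n (Nat.pos_of_ne_zero hn) a b h⟩
  let _ : AddCancelCommMonoid P := { ‹AddCommMonoid P›, ‹IsCancelAdd P› with }
  ext x
  refine ⟨fun hx ↦ AddMonoidAlgebra.mem_ideal_span_of'_image.2 fun q hq ↦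
    ⟨q, hx.mem_idealSatAbs hI hq, 0, (zero_add q).symm⟩, fun hx ↦ .of_isIntegral_reesAlgebra ?_⟩
  induction hx using Submodule.span_induction with
  | mem a ha =>
    obtain ⟨b, hb, rfl⟩ := ha
    exact isIntegral_reesAlgebra_single hb
  | zero => simpa using isIntegral_zero
  | add x y _ _ hx hy => simpa using hx.add hy
  | smul a x _ hx => simpa [Algebra.smul_def] using hx.smul a
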